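/- arXiv:1302.5008 — 2 statements merged into one kernel-verified Lean document; each statement's English description precedes it below -/
import Mathlib

section
/- Let d ≥ 3. For every ρ ∈ (0,1) there exists K > 0, depending only on ρ and d, such that for every past matrix N (i.e., every finite product of the matrices B₁ and B₂, including the identity): p({v ∈ Ω₁ : there exists n ≥ 0 with (Sⁿ(v))[d] < 2·(Sⁿ(v))[1] and C_max(N·M(v,n+1)) ≤ K·C_max(N)} | N) ≥ ρ. In words: regardless of the past, with conditional probability at least ρ the first entry leaves the critical position before the largest column sum increases by a factor of K. -/
open MeasureTheory

noncomputable section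

/-- The cone `Ω = {x ∈ ℝ^d : 0 ≤ x[1] ≤ … ≤ x[d] ≤ x[1]+x[2]}` intersected with the
hyperplane `{x : x[1]+⋯+x[d] = 1}`, i.e. `Ω₁`, for `d = m + 3`, inside Euclidean space. -/
def selmerSimplexE (m : ℕ) : Set (EuclideanSpace ℝ (Fin (m + 3))) :=
  {x | 0 ≤ x 0 ∧ (∀ i j : Fin (m + 3), i ≤ j → x i ≤ x j) ∧
    x (Fin.last (m + 2)) ≤ x 0 + x 1 ∧ ∑ i, x i = 1}

/-- The restricted Selmer map `S : Ω → Ω`: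
`S(x) = (x[1], x[d]−x[1], x[2], …, x[d−1])` if `x[d] ≥ 2x[1]`, and
`S(x) = (x[d]−x[1], x[1], x[2], …, x[d−1])` otherwise. -/
def selmerS (m : ℕ) (x : Fin (m + 3) → ℝ) : Fin (m + 3) → ℝ := fun i =>
  if (i : ℕ) = 0 then
    (if 2 * x 0 ≤ x (Fin.last (m + 2)) then x 0 else x (Fin.last (m + 2)) - x 0)
  else if (i : ℕ) = 1 then
    (if 2 * x 0 ≤ x (Fin.last (m + 2)) then x (Fin.last (m + 2)) - x 0 else x 0)
  else x ⟨(i : ℕ) - 1, by have := i.isLt; omega⟩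

/-- The matrix `B₁`, acting by `B₁y = (y[1], y[3], y[4], …, y[d], y[1]+y[2])`, so that
`B₁·S(x) = x` when `x[d] ≥ 2x[1]`. -/
def selmerB1 (m : ℕ) : Matrix (Fin (m + 3)) (Fin (m + 3)) ℝ :=
  Matrix.of fun i j =>
    if (i : ℕ) = 0 then (if (j : ℕ) = 0 then 1 else 0)
    else if (i : ℕ) = m + 2 then (if (j : ℕ) ≤ 1 then 1 else 0)
    else if (j : ℕ) = (i : ℕ) + 1 then 1 else 0

/-- The matrix `B₂`, acting by `B₂y = (y[2], y[3], y[4], …, y[d], y[1]+y[2])`, so that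
`B₂·S(x) = x` when `x[d] < 2x[1]`. -/
def selmerB2 (m : ℕ) : Matrix (Fin (m + 3)) (Fin (m + 3)) ℝ :=
  Matrix.of fun i j =>
    if (i : ℕ) = 0 then (if (j : ℕ) = 1 then 1 else 0)
    else if (i : ℕ) = m + 2 then (if (j : ℕ) ≤ 1 then 1 else 0)
    else if (j : ℕ) = (i : ℕ) + 1 then 1 else 0

/-- The one-step matrix `B_{ι(x)}`, where `ι(x) = 1` if `x[d] ≥ 2x[1]` and `ι(x) = 2`
otherwise. -/
def selmerStep (m : ℕ) (x : Fin (m + 3) → ℝ) : Matrix (Fin (m + 3)) (Fin (m + 3)) ℝ :=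
  if 2 * x 0 ≤ x (Fin.last (m + 2)) then selmerB1 m else selmerB2 m

/-- The matrix of induction `M(x,n) = B_{ι(x)}·B_{ι(S(x))}···B_{ι(S^{n−1}(x))}`
(with `M(x,0) = Id`), so that `M(x,n)·Sⁿ(x) = x`. -/
def selmerMat (m : ℕ) (x : Fin (m + 3) → ℝ) : ℕ → Matrix (Fin (m + 3)) (Fin (m + 3)) ℝ
  | 0 => 1
  | n + 1 => selmerMat m x n * selmerStep m ((selmerS m)^[n] x)

/-- The `j`-th column sum `C_j(N)` of a matrix. -/
def colSum (m : ℕ) (N : Matrix (Fin (m + 3)) (Fin (m + 3)) ℝ) (j : Fin (m + 3)) : ℝ :=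
  ∑ i, N i j

/-- The largest column sum `C_max(N)` of a matrix. -/
def colMax (m : ℕ) (N : Matrix (Fin (m + 3)) (Fin (m + 3)) ℝ) : ℝ :=
  ⨆ j, colSum m N j

/-- `N` is `β`-balanced if `β·C_j(N) ≥ C_max(N)` for every `j`. -/
def IsBalanced (m : ℕ) (β : ℝ) (N : Matrix (Fin (m + 3)) (Fin (m + 3)) ℝ) : Prop :=
  ∀ j, colMax m N ≤ β * colSum m N j

/-- The conditional probability of `U ⊆ Ω₁` given the past matrix `N`:
`p(U|N) = (∫_U (C₁v[1]+⋯+C_d v[d])^{−d} dλ₀) / (∫_{Ω₁} (C₁v[1]+⋯+C_d v[d])^{−d} dλ₀)`,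
where `C_j = C_j(N)` and `λ₀` is the `(d−1)`-dimensional Hausdorff measure. -/
def selmerCondP (m : ℕ) (N : Matrix (Fin (m + 3)) (Fin (m + 3)) ℝ)
    (U : Set (EuclideanSpace ℝ (Fin (m + 3)))) : ℝ :=
  (∫ v in U, ((∑ j, colSum m N j * v j) ^ (m + 3))⁻¹ ∂(μH[(m + 2 : ℝ)])) /
    (∫ v in selmerSimplexE m, ((∑ j, colSum m N j * v j) ^ (m + 3))⁻¹ ∂(μH[(m + 2 : ℝ)]))

end

def selInv (m : ℕ) (x : Fin (m + 3) → ℝ) : Prop :=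
  0 < x 0 ∧ (∀ i j : Fin (m + 3), i ≤ j → x i ≤ x j) ∧ x (Fin.last (m + 2)) ≤ x 0 + x 1

lemma selInv_S (m : ℕ) (x : Fin (m + 3) → ℝ) (hx : selInv m x)
    (h : 2 * x 0 ≤ x (Fin.last (m + 2))) : selInv m (selmerS m x) := by
  obtain ⟨h0, hm, hl⟩ := hx
  have e0 : selmerS m x 0 = x 0 := by simp [selmerS, h]
  have e1 : selmerS m x 1 = x (Fin.last (m + 2)) - x 0 := by simp [selmerS, h]
  have e2 : ∀ i : Fin (m + 3), 2 ≤ (i : ℕ) →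
      selmerS m x i = x ⟨(i : ℕ) - 1, by have := i.isLt; omega⟩ := by
    intro i hi
    unfold selmerS
    rw [if_neg (by omega), if_neg (by omega)]
  have h2 : ∀ i : Fin (m + 3), 2 ≤ (i : ℕ) → x 1 ≤ selmerS m x i := by
    intro i hi
    rw [e2 i hi]
    apply hm
    rw [Fin.le_def]
    simp
    omega
  refine ⟨by rw [e0]; exact h0, ?_, ?_⟩
  · intro i j hij
    rw [Fin.le_def] at hij
    rcases Nat.lt_or_ge (i : ℕ) 2 with hi | hi
    · rcases Nat.lt_or_ge (j : ℕ) 2 with hj | hj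
      · have hi' : i = 0 ∨ i = 1 := by
          rcases (show (i : ℕ) = 0 ∨ (i : ℕ) = 1 by omega) with q | q
          · left; exact Fin.ext (by simpa using q)
          · right; exact Fin.ext (by simpa using q)
        have hj' : j = 0 ∨ j = 1 := by
          rcases (show (j : ℕ) = 0 ∨ (j : ℕ) = 1 by omega) with q | q
          · left; exact Fin.ext (by simpa using q)
          · right; exact Fin.ext (by simpa using q)
        rcases hi' with rfl | rfl <;> rcases hj' with rfl | rfl
        · exact le_rfl
        · rw [e0, e1]; linarith
        · simp at hij
        · exact le_rfl
      · have := h2 j hj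
        have h01 := hm 0 1 (Fin.zero_le _)
        rcases (show (i : ℕ) = 0 ∨ (i : ℕ) = 1 by omega) with q | q
        · have : i = 0 := Fin.ext (by simpa using q)
          subst this
          rw [e0]; linarith
        · have : i = 1 := Fin.ext (by simpa using q)
          subst this
          rw [e1]; linarith
    · rw [e2 i hi, e2 j (by omega)]
      apply hm
      rw [Fin.le_def]
      simp
      omega
  · rw [e0, e1, e2 _ (by simp)]
    have := hm ⟨((Fin.last (m + 2) : Fin (m + 3)) : ℕ) - 1, by simp⟩ (Fin.last (m + 2)) (Fin.le_last _)
    linarith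

lemma selB1_mulVec (m : ℕ) (x : Fin (m + 3) → ℝ)
    (h : 2 * x 0 ≤ x (Fin.last (m + 2))) (i : Fin (m + 3)) :
    ∑ j, selmerB1 m i j * selmerS m x j = x i := by
  have e0 : selmerS m x 0 = x 0 := by simp [selmerS, h]
  have e1 : selmerS m x 1 = x (Fin.last (m + 2)) - x 0 := by simp [selmerS, h]
  by_cases hi0 : (i : ℕ) = 0
  · have : i = 0 := Fin.ext (by simpa using hi0)
    subst this
    rw [Finset.sum_eq_single 0]
    · simp [selmerB1, e0]
    · intro b _ hb
      have : (b : ℕ) ≠ 0 := fun q => hb (Fin.ext (by simpa using q))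
      simp [selmerB1, hb]
    · simp
  by_cases hil : (i : ℕ) = m + 2
  · have : i = Fin.last (m + 2) := Fin.ext (by simpa using hil)
    subst this
    rw [Fin.sum_univ_succ, Fin.sum_univ_succ, Finset.sum_eq_zero]
    · have : (Fin.succ 0 : Fin (m + 3)) = 1 := rfl
      rw [this, e0, e1]
      simp [selmerB1]
    · intro b _
      simp [selmerB1]
  · have hlt := i.isLt
    rw [Finset.sum_eq_single ⟨(i : ℕ) + 1, by omega⟩]
    · have hi0' : i ≠ 0 := fun q => hi0 (by simp [q])
      simp [selmerB1, hi0', hil, selmerS]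
    · intro b _ hb
      have : (b : ℕ) ≠ i + 1 := fun q => hb (Fin.ext (by simpa using q))
      have hi0' : i ≠ 0 := fun q => hi0 (by simp [q])
      simp [selmerB1, this, hi0', hil]
    · simp

lemma selS_sum (m : ℕ) (x : Fin (m + 3) → ℝ)
    (h : 2 * x 0 ≤ x (Fin.last (m + 2))) : ∑ j, selmerS m x j = ∑ j, x j - x 0 := by
  rw [Fin.sum_univ_succ, Fin.sum_univ_succ, Fin.sum_univ_succ (f := x),
    Fin.sum_univ_castSucc (f := fun i : Fin (m + 2) => x i.succ)]
  have e0 : selmerS m x 0 = x 0 := by simp [selmerS, h]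
  have e1 : selmerS m x (Fin.succ 0) = x (Fin.last (m + 2)) - x 0 := by simp [selmerS, h]
  rw [e0, e1]
  have : ∀ i : Fin (m + 1), selmerS m x i.succ.succ = x i.castSucc.succ := by
    intro i
    unfold selmerS
    rw [if_neg (by simp), if_neg (by simp)]
    congr 1
  simp only [this]
  rw [Fin.succ_last]
  ring

lemma colSum_mul (m : ℕ) (N B : Matrix (Fin (m + 3)) (Fin (m + 3)) ℝ) (j : Fin (m + 3)) :
    colSum m (N * B) j = ∑ k, colSum m N k * B k j := by
  simp only [colSum, Matrix.mul_apply, Finset.sum_mul]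
  rw [Finset.sum_comm]

lemma selB_props (m : ℕ) (B : Matrix (Fin (m + 3)) (Fin (m + 3)) ℝ)
    (hB : B = selmerB1 m ∨ B = selmerB2 m) :
    (∀ k j, 0 ≤ B k j) ∧ (∀ j, ∃ k, 0 < B k j) ∧ ∀ j, ∑ k, B k j ≤ 2 := by
  have key : (∀ k j, 0 ≤ B k j) ∧ ∀ k j : Fin (m + 3), B k j ≤ 1 := by
    rcases hB with rfl | rfl <;>
    · constructor <;> intro k j <;> simp only [selmerB1, selmerB2, Matrix.of_apply] <;> 
        split_ifs <;> norm_num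
  refine ⟨key.1, ?_, ?_⟩
  · intro j
    have hj := j.isLt
    by_cases h : (j : ℕ) ≤ 1
    · refine ⟨Fin.last _, ?_⟩
      rcases hB with rfl | rfl <;> simp [selmerB1, selmerB2, h]
    · refine ⟨⟨(j : ℕ) - 1, by omega⟩, ?_⟩
      have h1 : (j : ℕ) - 1 ≠ 0 := by omega
      have h2 : (j : ℕ) - 1 ≠ m + 2 := by omega
      have h3 : (j : ℕ) = (j : ℕ) - 1 + 1 := by omega
      rcases hB with rfl | rfl <;> simp only [selmerB1, selmerB2, Matrix.of_apply] <;>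
        rw [if_neg h1, if_neg h2, if_pos h3] <;> norm_num
  · intro j
    have hj := j.isLt
    have fin : ∀ s : Finset (Fin (m + 3)), s.card ≤ 2 → (∀ k, k ∉ s → B k j = 0) →
        ∑ k, B k j ≤ 2 := by
      intro s hs h
      rw [← Finset.sum_subset (Finset.subset_univ s) (fun k _ hk => h k hk)]
      calc ∑ k ∈ s, B k j ≤ ∑ k ∈ s, (1 : ℝ) := Finset.sum_le_sum (fun k _ => key.2 k j)
        _ = s.card := by simp
        _ ≤ 2 := by exact_mod_cast hs
    by_cases h : (j : ℕ) ≤ 1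
    · apply fin {0, Fin.last _} Finset.card_le_two
      intro k hk
      simp only [Finset.mem_insert, Finset.mem_singleton, not_or] at hk
      have h1 : (k : ℕ) ≠ 0 := fun q => hk.1 (Fin.ext (by simpa using q))
      have h2 : (k : ℕ) ≠ m + 2 := fun q => hk.2 (Fin.ext (by simpa using q))
      have h3 : (j : ℕ) ≠ k + 1 := by omega
      rcases hB with rfl | rfl <;> simp only [selmerB1, selmerB2, Matrix.of_apply] <;>
        rw [if_neg h1, if_neg h2, if_neg h3]
    · apply fin {⟨(j : ℕ) - 1, by omega⟩} (by simp)
      intro k hk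
      simp only [Finset.mem_singleton, Fin.ext_iff] at hk
      have h0 : j ≠ 0 := fun q => h (by simp [q])
      have h1 : (j : ℕ) ≠ 1 := by omega
      have h3 : (j : ℕ) ≠ k + 1 := by omega
      rcases hB with rfl | rfl <;> simp [selmerB1, selmerB2, h, h0, h1, h3]

lemma colSum_mul_pos (m : ℕ) (N B : Matrix (Fin (m + 3)) (Fin (m + 3)) ℝ)
    (hB : B = selmerB1 m ∨ B = selmerB2 m) (hN : ∀ j, 0 < colSum m N j) (j : Fin (m + 3)) :
    0 < colSum m (N * B) j := by
  rw [colSum_mul]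
  obtain ⟨h0, h1, -⟩ := selB_props m B hB
  obtain ⟨k, hk⟩ := h1 j
  exact Finset.sum_pos' (fun k _ => mul_nonneg (hN k).le (h0 k j))
    ⟨k, Finset.mem_univ _, mul_pos (hN k) hk⟩

lemma colSum_pos_of_mem (m : ℕ) (N : Matrix (Fin (m + 3)) (Fin (m + 3)) ℝ)
    (hN : N ∈ Submonoid.closure {selmerB1 m, selmerB2 m}) : ∀ j, 0 < colSum m N j := by
  induction hN using Submonoid.closure_induction_right with
  | one => intro j; simp [colSum, Matrix.one_apply]
  | mul_right x hx y hy ih => exact colSum_mul_pos m x y hy ih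

lemma selmerMat_succ' (m : ℕ) (x : Fin (m + 3) → ℝ) (n : ℕ) :
    selmerMat m x (n + 1) = selmerStep m x * selmerMat m (selmerS m x) n := by
  induction n with
  | zero => simp [selmerMat]
  | succ n ih =>
    rw [selmerMat, ih, Matrix.mul_assoc, selmerMat, Function.iterate_succ_apply]

lemma sel_dyn (m : ℕ) (k : ℕ) : ∀ (x : Fin (m + 3) → ℝ)
    (N : Matrix (Fin (m + 3)) (Fin (m + 3)) ℝ), selInv m x → (∀ j, 0 < colSum m N j) →
    ∑ j, x j ≤ k * x 0 → ∃ n : ℕ,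
      ((selmerS m)^[n] x) (Fin.last (m + 2)) < 2 * ((selmerS m)^[n] x) 0 ∧
        colMax m (N * selmerMat m x (n + 1)) ≤ 2 * ((∑ j, colSum m N j * x j) / x 0) := by
  induction k with
  | zero =>
    intro x N hx hN hs
    exfalso
    obtain ⟨h0, hm, -⟩ := hx
    have : 0 < ∑ j, x j :=
      Finset.sum_pos (fun j _ => lt_of_lt_of_le h0 (hm 0 j (Fin.zero_le _))) ⟨0, Finset.mem_univ _⟩
    simp at hs
    linarith
  | succ k ih =>
    intro x N hx hN hs
    by_cases h : 2 * x 0 ≤ x (Fin.last (m + 2))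
    · have e0 : selmerS m x 0 = x 0 := by simp [selmerS, h]
      obtain ⟨n, hn1, hn2⟩ := ih (selmerS m x) (N * selmerB1 m) (selInv_S m x hx h)
        (colSum_mul_pos m N _ (Or.inl rfl) hN) (by
          rw [selS_sum m x h, e0]; push_cast at hs; linarith)
      refine ⟨n + 1, by simpa only [Function.iterate_succ_apply] using hn1, ?_⟩
      rw [selmerMat_succ', selmerStep, if_pos h, ← Matrix.mul_assoc]
      refine hn2.trans (le_of_eq ?_)
      rw [e0]
      congr 2
      simp only [colSum_mul, Finset.sum_mul]
      rw [Finset.sum_comm]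
      refine Finset.sum_congr rfl fun i _ => ?_
      simp only [mul_assoc]
      rw [← Finset.mul_sum, selB1_mulVec m x h]
    · refine ⟨0, by simpa using h, ?_⟩
      obtain ⟨h0, hm, -⟩ := hx
      simp only [selmerMat, Function.iterate_zero, id, one_mul]
      rw [selmerStep, if_neg h]
      set Q := (∑ j, colSum m N j * x j) / x 0 with hQ
      have hCQ : ∀ j, colSum m N j ≤ Q := by
        intro j
        rw [hQ, le_div_iff₀ h0]
        calc colSum m N j * x 0 ≤ colSum m N j * x j :=
              mul_le_mul_of_nonneg_left (hm 0 j (Fin.zero_le _)) (hN j).le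
          _ ≤ _ := Finset.single_le_sum (f := fun j => colSum m N j * x j)
              (fun i _ => mul_nonneg (hN i).le (h0.le.trans (hm 0 i (Fin.zero_le _))))
              (Finset.mem_univ j)
      obtain ⟨hb0, -, hb2⟩ := selB_props m _ (Or.inr rfl)
      refine ciSup_le fun j => ?_
      rw [colSum_mul]
      calc ∑ k, colSum m N k * selmerB2 m k j ≤ ∑ k, Q * selmerB2 m k j :=
            Finset.sum_le_sum fun k _ => mul_le_mul_of_nonneg_right (hCQ k) (hb0 k j)
        _ = Q * ∑ k, selmerB2 m k j := by rw [Finset.mul_sum]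
        _ ≤ Q * 2 := mul_le_mul_of_nonneg_left (hb2 j) ((hN 0).le.trans (hCQ 0))
        _ = _ := by ring

/-- The affine parametrisation of the hyperplane `∑ x = 1` by the last `m + 2` coordinates. -/
def selPar (m : ℕ) (y : Fin (m + 2) → ℝ) : EuclideanSpace ℝ (Fin (m + 3)) :=
  WithLp.toLp 2 (Fin.cons (1 - ∑ i, y i) y : Fin (m + 3) → ℝ)

lemma selPar_zero (m : ℕ) (y : Fin (m + 2) → ℝ) : selPar m y 0 = 1 - ∑ i, y i := by
  simp [selPar]

lemma selPar_succ (m : ℕ) (y : Fin (m + 2) → ℝ) (i : Fin (m + 2)) :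
    selPar m y i.succ = y i := by
  simp [selPar]

lemma selPar_sum (m : ℕ) (y : Fin (m + 2) → ℝ) : ∑ i, selPar m y i = 1 := by
  rw [Fin.sum_univ_succ, selPar_zero]
  simp [selPar_succ]

lemma selPar_eq (m : ℕ) (x : EuclideanSpace ℝ (Fin (m + 3))) (hx : ∑ i, x i = 1) :
    selPar m (fun i => x i.succ) = x := by
  ext i
  refine Fin.cases ?_ (fun j => ?_) i
  · rw [selPar_zero, ← hx, Fin.sum_univ_succ]; ring
  · rw [selPar_succ]

lemma selPar_lip (m : ℕ) : ∃ K, LipschitzWith K (selPar m) := by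
  have h1 : LipschitzWith ((m : NNReal) + 2)
      (fun y : Fin (m + 2) → ℝ => (Fin.cons (1 - ∑ i, y i) y : Fin (m + 3) → ℝ)) := by
    apply LipschitzWith.of_dist_le_mul
    intro y z
    have hnn : 0 ≤ ((m : ℝ) + 2) * dist y z := by positivity
    push_cast
    rw [dist_pi_le_iff hnn]
    intro i
    refine Fin.cases ?_ (fun j => ?_) i
    · simp only [Fin.cons_zero]
      rw [dist_sub_left, dist_eq_norm, ← Finset.sum_sub_distrib]
      refine (norm_sum_le _ _).trans ?_
      calc ∑ i, ‖y i - z i‖ ≤ ∑ _i : Fin (m + 2), dist y z := 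
            Finset.sum_le_sum fun i _ => by rw [← dist_eq_norm]; exact dist_le_pi_dist y z i
        _ = _ := by simp
    · simp only [Fin.cons_succ]
      refine (dist_le_pi_dist y z j).trans ?_
      have : 0 ≤ dist y z := dist_nonneg
      nlinarith
  exact ⟨_, (PiLp.lipschitzWith_toLp 2 (fun _ : Fin (m + 3) => ℝ)).comp h1⟩

lemma selOmega_bounds (m : ℕ) (x : EuclideanSpace ℝ (Fin (m + 3))) (hx : x ∈ selmerSimplexE m) :
    (∀ i, 0 ≤ x i) ∧ (∀ i, x i ≤ 1) ∧ 1 ≤ 2 * (m + 3 : ℝ) * x 1 := by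
  obtain ⟨h0, hm, hl, hs⟩ := hx
  have hnn : ∀ i, 0 ≤ x i := fun i => h0.trans (hm 0 i (Fin.zero_le _))
  refine ⟨hnn, fun i => ?_, ?_⟩
  · rw [← hs]
    exact Finset.single_le_sum (f := fun i => x i) (fun i _ => hnn i) (Finset.mem_univ i)
  · have h01 := hm 0 1 (Fin.zero_le _)
    calc (1 : ℝ) = ∑ i, x i := hs.symm
      _ ≤ ∑ _i : Fin (m + 3), 2 * x 1 := Finset.sum_le_sum fun i _ => by
          have := hm i _ (Fin.le_last i); linarith
      _ = _ := by simp; ring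

lemma selHaus (m : ℕ) : (μH[(m + 2 : ℝ)] : Measure (Fin (m + 2) → ℝ)) = volume := by
  rw [← hausdorffMeasure_pi_real]
  simp

lemma selOmega_fin (m : ℕ) : μH[(m + 2 : ℝ)] (selmerSimplexE m) ≠ ⊤ := by
  obtain ⟨K, hK⟩ := selPar_lip m
  have hsub : selmerSimplexE m ⊆ selPar m '' (Set.Icc 0 1) := by
    intro x hx
    obtain ⟨h0, h1, -⟩ := selOmega_bounds m x hx
    refine ⟨fun i => x i.succ, ⟨fun i => h0 _, fun i => h1 _⟩, selPar_eq m x hx.2.2.2⟩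
  refine ne_top_of_le_ne_top ?_ ((measure_mono hsub).trans
    (hK.hausdorffMeasure_image_le (by positivity) _))
  rw [selHaus]
  refine ENNReal.mul_ne_top ?_ ?_
  · exact ENNReal.rpow_ne_top_of_nonneg (by positivity) ENNReal.coe_ne_top
  · exact (isCompact_Icc.measure_lt_top).ne

lemma selOmega_pos (m : ℕ) : 0 < μH[(m + 2 : ℝ)] (selmerSimplexE m) := by
  let g : EuclideanSpace ℝ (Fin (m + 3)) → (Fin (m + 2) → ℝ) := fun x i => x i.succ
  have hg : LipschitzWith 1 g := by
    have h2 : LipschitzWith 1 (fun (x : Fin (m + 3) → ℝ) (i : Fin (m + 2)) => x i.succ) := by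
      apply LipschitzWith.of_dist_le_mul
      intro y z
      rw [NNReal.coe_one, one_mul, dist_pi_le_iff dist_nonneg]
      intro i
      exact dist_le_pi_dist y z i.succ
    have := h2.comp (PiLp.lipschitzWith_ofLp 2 (fun _ : Fin (m + 3) => ℝ))
    rw [one_mul] at this
    exact this
  let V : Set (Fin (m + 2) → ℝ) := {y | 0 < selPar m y 0 ∧
    (∀ i j : Fin (m + 3), i < j → selPar m y i < selPar m y j) ∧
    selPar m y (Fin.last (m + 2)) < selPar m y 0 + selPar m y 1}
  have hc : ∀ i, Continuous fun y => selPar m y i := by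
    obtain ⟨K, hK⟩ := selPar_lip m
    intro i
    have := hK.continuous
    fun_prop
  have hV : IsOpen V := by
    have hmid : IsOpen {y : Fin (m + 2) → ℝ |
        ∀ i j : Fin (m + 3), i < j → selPar m y i < selPar m y j} := by
      simp only [Set.ofPred_forall]
      exact isOpen_iInter_of_finite fun i => isOpen_iInter_of_finite fun j =>
      isOpen_iInter_of_finite fun _ => isOpen_lt (hc i) (hc j)
    exact (isOpen_lt continuous_const (hc 0)).inter (hmid.inter
      (isOpen_lt (hc _) ((hc 0).add (hc 1))))
  have hVne : V.Nonempty := by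
    let q : Fin (m + 3) → ℝ := fun i => (m + 3 : ℝ) + (i : ℕ)
    let s := ∑ i, q i
    have hq : ∀ i, 0 < q i := fun i => by positivity
    have hs : 0 < s := Finset.sum_pos (fun i _ => hq i) ⟨0, Finset.mem_univ _⟩
    let p : EuclideanSpace ℝ (Fin (m + 3)) := WithLp.toLp 2 (fun i => q i / s)
    have hp : ∀ i, p i = q i / s := fun i => rfl
    have hp1 : ∑ i, p i = 1 := by
      simp only [hp]
      rw [← Finset.sum_div]
      exact div_self hs.ne'
    refine ⟨fun i => p i.succ, ?_⟩
    simp only [V, Set.mem_ofPred_eq]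
    rw [selPar_eq m p hp1]
    refine ⟨div_pos (hq 0) hs, fun i j hij => ?_, ?_⟩
    · rw [hp, hp]
      refine div_lt_div_of_pos_right ?_ hs
      have : ((i : ℕ) : ℝ) < (j : ℕ) := by exact_mod_cast hij
      simp only [q]; linarith
    · rw [hp, hp, hp, ← add_div]
      refine div_lt_div_of_pos_right ?_ hs
      simp [q]
      linarith
  have hsub : V ⊆ g '' selmerSimplexE m := by
    intro y hy
    refine ⟨selPar m y, ⟨hy.1.le, fun i j hij => ?_, hy.2.2.le, selPar_sum m y⟩, ?_⟩
    · rcases hij.eq_or_lt with rfl | h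
      · exact le_rfl
      · exact (hy.2.1 i j h).le
    · ext i
      exact selPar_succ m y i
  have h1 : 0 < μH[(m + 2 : ℝ)] V := by
    rw [selHaus]
    exact hV.measure_pos _ hVne
  have h2 := (measure_mono hsub).trans (hg.hausdorffMeasure_image_le
    (d := (m + 2 : ℝ)) (by positivity) (selmerSimplexE m))
  rw [ENNReal.coe_one, ENNReal.one_rpow, one_mul] at h2
  exact h1.trans_le h2

lemma selOmega_closed (m : ℕ) : IsClosed (selmerSimplexE m) := by
  have hc : ∀ i : Fin (m + 3), Continuous fun y : EuclideanSpace ℝ (Fin (m + 3)) => y i := by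
    intro i; fun_prop
  have hmid : IsClosed {y : EuclideanSpace ℝ (Fin (m + 3)) |
      ∀ i j : Fin (m + 3), i ≤ j → y i ≤ y j} := by
    simp only [Set.ofPred_forall]
    exact isClosed_iInter fun i => isClosed_iInter fun j =>
      isClosed_iInter fun _ => isClosed_le (hc i) (hc j)
  exact (isClosed_le continuous_const (hc 0)).inter (hmid.inter
      ((isClosed_le (hc _) ((hc 0).add (hc 1))).inter
      (isClosed_eq (continuous_finsetSum _ fun i _ => hc i) continuous_const)))

/-- The part of the simplex where the first entry is at most `r`. -/
def selA (m : ℕ) (r : ℝ) : Set (EuclideanSpace ℝ (Fin (m + 3))) :=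
  selmerSimplexE m ∩ {v | v 0 ≤ r}

/-- The vertex `(0,1,…,1)/(d-1)`. -/
noncomputable def selW (m : ℕ) : EuclideanSpace ℝ (Fin (m + 3)) :=
  WithLp.toLp 2 (Fin.cons 0 (fun _ => 1 / (m + 2 : ℝ)) : Fin (m + 3) → ℝ)

lemma selA_scale (m : ℕ) (r t : ℝ) (ht : 0 < t) (ht1 : t ≤ 1) (hr : r ≤ 1 / (2 * (m + 3 : ℝ))) :
    μH[(m + 2 : ℝ)].real (selA m (t * r)) ≤ t * μH[(m + 2 : ℝ)].real (selA m r) := by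
  have hw0 : selW m 0 = 0 := by simp [selW]
  have hws : ∀ i : Fin (m + 2), selW m i.succ = 1 / (m + 2 : ℝ) := fun i => by simp [selW]
  have hwsum : ∑ i, selW m i = 1 := by
    rw [Fin.sum_univ_succ, hw0]
    simp only [hws]
    simp
    field_simp
  have hsub : selA m (t * r) ⊆ AffineMap.homothety (selW m) t '' selA m r := by
    rintro v ⟨⟨h0, hm, hl, hs⟩, hvr⟩
    simp only [Set.mem_ofPred_eq] at hvr
    have hu : ∀ i, (AffineMap.homothety (selW m) t⁻¹ v) i = t⁻¹ * (v i - selW m i) + selW m i := by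
      intro i
      simp [AffineMap.homothety_apply]
    have hti : 0 < t⁻¹ := inv_pos.mpr ht
    set u := AffineMap.homothety (selW m) t⁻¹ v with hudef
    have husum : ∑ i, u i = 1 := by
      simp only [hu]
      rw [Finset.sum_add_distrib, ← Finset.mul_sum, Finset.sum_sub_distrib, hs, hwsum]
      ring
    have hu0 : u 0 = t⁻¹ * v 0 := by rw [hu, hw0]; ring
    have hu0r : u 0 ≤ r := by
      rw [hu0, inv_mul_le_iff₀ ht]; exact hvr
    have hu0n : 0 ≤ u 0 := by rw [hu0]; positivity
    have hus : ∀ i j : Fin (m + 2), i ≤ j → u i.succ ≤ u j.succ := by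
      intro i j hij
      rw [hu, hu, hws, hws]
      have := hm i.succ j.succ (Fin.succ_le_succ_iff.mpr hij)
      gcongr
    have hul : u (Fin.last (m + 2)) ≤ u 0 + u 1 := by
      rw [hu0, hu, hu, ← Fin.succ_last, hws, show (1 : Fin (m + 3)) = Fin.succ 0 from rfl, hws]
      rw [← Fin.succ_last] at hl
      have := mul_le_mul_of_nonneg_left hl hti.le
      rw [show (1 : Fin (m + 3)) = Fin.succ 0 from rfl] at this
      linarith
    have hu01 : u 0 ≤ u 1 := by
      by_contra hcon
      push Not at hcon
      have : ∑ i, u i < ∑ _i : Fin (m + 3), 2 * u 0 := by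
        refine Finset.sum_lt_sum_of_nonempty ⟨0, Finset.mem_univ _⟩ fun i _ => ?_
        refine Fin.cases ?_ (fun j => ?_) i
        · have h01 : u 1 ≤ u (Fin.last (m + 2)) := hus 0 (Fin.last _) (Fin.zero_le _)
          rcases hu0n.eq_or_lt with h | h
          · exfalso
            have h2 : u 1 = t⁻¹ * v 1 + (1 - t⁻¹) * (1 / (m + 2 : ℝ)) := by
              rw [hu, show (1 : Fin (m + 3)) = Fin.succ 0 from rfl, hws]; ring
            have hall : ∀ j : Fin (m + 2), u j.succ = u 1 := by
              intro j
              refine le_antisymm ?_ (hus 0 j (Fin.zero_le _))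
              have := hus j (Fin.last _) (Fin.le_last _)
              rw [Fin.succ_last] at this
              linarith
            rw [Fin.sum_univ_succ, ← h] at husum
            simp only [hall] at husum
            simp at husum
            have : ((m : ℝ) + 2) * u 1 < 0 := by
              apply mul_neg_of_pos_of_neg (by positivity); linarith
            linarith
          · linarith
        · have := hus j (Fin.last _) (Fin.le_last _)
          rw [Fin.succ_last] at this
          linarith
      rw [husum] at this
      simp at this
      have h3 : u 0 ≤ 1 / (2 * (m + 3 : ℝ)) := hu0r.trans hr
      rw [le_div_iff₀ (by positivity)] at h3
      linarith
    refine ⟨u, ⟨⟨hu0n, ?_, hul, husum⟩, hu0r⟩, ?_⟩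
    · intro i j
      refine Fin.cases ?_ (fun i' => ?_) i
      · refine Fin.cases ?_ (fun j' => ?_) j
        · intro _; exact le_rfl
        · intro _; exact hu01.trans (hus 0 j' (Fin.zero_le _))
      · refine Fin.cases ?_ (fun j' => ?_) j
        · intro h; exact absurd h (by simp)
        · intro h; exact hus i' j' (Fin.succ_le_succ_iff.mp h)
    · ext i
      simp only [AffineMap.homothety_apply, vsub_eq_sub, vadd_eq_add, PiLp.add_apply,
        PiLp.smul_apply, PiLp.sub_apply, smul_eq_mul, hu]
      field_simp
      ring
  have hfin : μH[(m + 2 : ℝ)] (selA m r) ≠ ⊤ :=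
    ne_top_of_le_ne_top (selOmega_fin m) (measure_mono Set.inter_subset_left)
  have h1 := measure_mono (μ := μH[(m + 2 : ℝ)]) hsub
  rw [hausdorffMeasure_homothety_image (by positivity) _ ht.ne'] at h1
  have h2 := ENNReal.toReal_mono (by
    rw [ENNReal.smul_def, smul_eq_mul]
    exact ENNReal.mul_ne_top ENNReal.coe_ne_top hfin) h1
  rw [ENNReal.smul_def, smul_eq_mul, ENNReal.toReal_mul, ENNReal.coe_toReal, NNReal.coe_rpow,
    coe_nnnorm, Real.norm_of_nonneg ht.le] at h2
  refine h2.trans ?_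
  refine mul_le_mul_of_nonneg_right ?_ ENNReal.toReal_nonneg
  calc t ^ (m + 2 : ℝ) ≤ t ^ (1 : ℝ) := Real.rpow_le_rpow_of_exponent_ge ht ht1 (by
        have : (0 : ℝ) ≤ m := by positivity
        linarith)
    _ = t := Real.rpow_one t

/-- Key measure estimate: for a linear form with positive coefficients bounded by `c`, the set
where the first entry is small compared with the form has small weighted measure. -/
lemma sel_measure (m : ℕ) (C : Fin (m + 3) → ℝ) (c : ℝ) (hC : ∀ j, 0 < C j) (hc : ∀ j, C j ≤ c)
    (t : ℝ) (ht : 0 < t) (ht1 : t ≤ 1) (δ : ℝ) (hδ : δ = t / (4 * (m + 3 : ℝ) ^ 2))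
    (U : Set (EuclideanSpace ℝ (Fin (m + 3)))) (hU : U ⊆ selmerSimplexE m)
    (hgood : ∀ v ∈ selmerSimplexE m, δ * ∑ j, C j * v j ≤ c * v 0 → v ∈ U) :
    1 - (4 * (m + 3 : ℝ)) ^ (m + 3) * t ≤
    (∫ v in U, ((∑ j, C j * v j) ^ (m + 3))⁻¹ ∂(μH[(m + 2 : ℝ)])) /
    (∫ v in selmerSimplexE m, ((∑ j, C j * v j) ^ (m + 3))⁻¹ ∂(μH[(m + 2 : ℝ)])) := by
  set μ : Measure (EuclideanSpace ℝ (Fin (m + 3))) := μH[(m + 2 : ℝ)] with hμ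
  set D : ℝ := (m : ℝ) + 3 with hD
  have hD3 : 3 ≤ D := by rw [hD]; have : (0 : ℝ) ≤ m := by positivity
                         linarith
  have hD0 : 0 < D := by linarith
  set L : EuclideanSpace ℝ (Fin (m + 3)) → ℝ := fun v => ∑ j, C j * v j with hL
  set f : EuclideanSpace ℝ (Fin (m + 3)) → ℝ := fun v => (L v ^ (m + 3))⁻¹ with hf
  set G : ℝ := ∑ j : Fin (m + 2), C j.succ with hG
  have hc0 : 0 < c := (hC 0).trans_le (hc 0)
  have hG0 : 0 < G := Finset.sum_pos (fun j _ => hC _) ⟨0, Finset.mem_univ _⟩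
  have hGc : G ≤ D * c := by
    calc G ≤ ∑ _j : Fin (m + 2), c := Finset.sum_le_sum fun j _ => hc _
      _ = (m + 2 : ℝ) * c := by simp
      _ ≤ D * c := by apply mul_le_mul_of_nonneg_right _ hc0.le; rw [hD]; linarith
  have hLc : Continuous L := by rw [hL]; fun_prop
  have hLs : ∀ v, L v = C 0 * v 0 + ∑ j : Fin (m + 2), C j.succ * v j.succ := fun v => by
    rw [hL]; exact Fin.sum_univ_succ _
  have hLlow : ∀ v ∈ selmerSimplexE m, G / (2 * D) ≤ L v := by
    intro v hv
    obtain ⟨h0, h1, h2⟩ := selOmega_bounds m v hv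
    rw [hLs]
    have h3 : G * v 1 ≤ ∑ j : Fin (m + 2), C j.succ * v j.succ := by
      rw [hG, Finset.sum_mul]
      exact Finset.sum_le_sum fun j _ => mul_le_mul_of_nonneg_left
        (hv.2.1 1 j.succ (Fin.succ_le_succ_iff.mpr (Fin.zero_le j))) (hC _).le
    have h4 : 0 ≤ C 0 * v 0 := mul_nonneg (hC 0).le (h0 0)
    rw [div_le_iff₀ (by positivity)]
    have h5 : G ≤ G * v 1 * (2 * D) := by
      have := mul_le_mul_of_nonneg_left h2 hG0.le
      rw [hD]; linarith
    have h6 := mul_le_mul_of_nonneg_right h3 (show 0 ≤ 2 * D by positivity)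
    have h7 := mul_nonneg h4 (show 0 ≤ 2 * D by positivity)
    linarith
  have hLup : ∀ v ∈ selmerSimplexE m, L v ≤ c * v 0 + G := by
    intro v hv
    obtain ⟨h0, h1, h2⟩ := selOmega_bounds m v hv
    rw [hLs]
    refine add_le_add (mul_le_mul_of_nonneg_right (hc 0) (h0 0)) ?_
    exact Finset.sum_le_sum fun j _ => mul_le_of_le_one_right (hC _).le (h1 _)
  have hLpos : ∀ v ∈ selmerSimplexE m, 0 < L v := fun v hv =>
    lt_of_lt_of_le (by positivity) (hLlow v hv)
  have hfpos : ∀ v ∈ selmerSimplexE m, 0 < f v := fun v hv =>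
    inv_pos.mpr (pow_pos (hLpos v hv) _)
  have hfup : ∀ v ∈ selmerSimplexE m, f v ≤ ((G / (2 * D)) ^ (m + 3))⁻¹ := fun v hv =>
    inv_anti₀ (by positivity) (pow_le_pow_left₀ (by positivity) (hLlow v hv) _)
  have hΩm : MeasurableSet (selmerSimplexE m) := (selOmega_closed m).measurableSet
  have hfm : Measurable f := (hLc.measurable.pow_const _).inv
  have hint : IntegrableOn f (selmerSimplexE m) μ := by
    refine Measure.integrableOn_of_bounded (M := ((G / (2 * D)) ^ (m + 3))⁻¹) (selOmega_fin m)
      hfm.aestronglyMeasurable ?_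
    refine (ae_restrict_iff' hΩm).mpr (Filter.Eventually.of_forall fun v hv => ?_)
    rw [Real.norm_of_nonneg (hfpos v hv).le]
    exact hfup v hv
  have hae : 0 ≤ᵐ[μ.restrict (selmerSimplexE m)] f :=
    (ae_restrict_iff' hΩm).mpr (Filter.Eventually.of_forall fun v hv => (hfpos v hv).le)
  have hI : 0 < ∫ v in selmerSimplexE m, f v ∂μ := by
    rw [setIntegral_pos_iff_support_of_nonneg_ae hae hint]
    have : Function.support f ∩ selmerSimplexE m = selmerSimplexE m :=
      Set.inter_eq_right.mpr fun v hv => (hfpos v hv).ne'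
    rw [this]
    exact selOmega_pos m
  -- the good and bad sets
  set P : Set (EuclideanSpace ℝ (Fin (m + 3))) := selmerSimplexE m ∩ {v | δ * L v ≤ c * v 0} with hP
  have hPm : MeasurableSet P := ((selOmega_closed m).inter
    (isClosed_le (by fun_prop) (by fun_prop))).measurableSet
  have hPU : P ⊆ U := fun v hv => hgood v hv.1 hv.2
  have hPΩ : P ⊆ selmerSimplexE m := Set.inter_subset_left
  have hδ0 : 0 < δ := by rw [hδ]; positivity
  have hδh : δ ≤ 1 / 2 := by
    rw [hδ, div_le_iff₀ (by positivity)]; nlinarith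
  set r : ℝ := G / (2 * D ^ 2 * c) with hr
  have hr1 : r ≤ 1 / (2 * D) := by
    rw [hr, div_le_div_iff₀ (by positivity) (by positivity)]
    nlinarith
  have hbad : selmerSimplexE m \ P ⊆ selA m (t * r) := by
    rintro v ⟨hv, hvP⟩
    refine ⟨hv, ?_⟩
    have h1 : c * v 0 < δ * L v := by
      by_contra h
      exact hvP ⟨hv, not_lt.mp h⟩
    have h2 := mul_le_mul_of_nonneg_left (hLup v hv) hδ0.le
    have h0 := (selOmega_bounds m v hv).1 0
    have h3 : c * v 0 ≤ 2 * δ * G := by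
      have : 0 ≤ c * v 0 := by positivity
      nlinarith
    change v 0 ≤ t * r
    have h4 : t * r = 2 * δ * G / c := by
      rw [hr, hδ]; field_simp; ring
    rw [h4, le_div_iff₀ hc0]
    linarith
  have hAm : ∀ s, MeasurableSet (selA m s) := fun s => ((selOmega_closed m).inter
    (isClosed_le (by fun_prop) (by fun_prop))).measurableSet
  have hAΩ : ∀ s, selA m s ⊆ selmerSimplexE m := fun s => Set.inter_subset_left
  have hAfin : ∀ s, μ (selA m s) ≠ ⊤ := fun s =>
    ne_top_of_le_ne_top (selOmega_fin m) (measure_mono (hAΩ s))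
  have hAae : ∀ s, 0 ≤ᵐ[μ.restrict (selA m s)] f := fun s =>
    ae_restrict_of_ae_restrict_of_subset (hAΩ s) hae
  have hB1 : ∫ v in selmerSimplexE m \ P, f v ∂μ ≤
      μ.real (selA m (t * r)) * ((G / (2 * D)) ^ (m + 3))⁻¹ := by
    calc ∫ v in selmerSimplexE m \ P, f v ∂μ ≤ ∫ v in selA m (t * r), f v ∂μ :=
          setIntegral_mono_set (hint.mono_set (hAΩ _)) (hAae _)
            (Filter.Eventually.of_forall hbad)
      _ ≤ ∫ v in selA m (t * r), ((G / (2 * D)) ^ (m + 3))⁻¹ ∂μ :=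
          setIntegral_mono_on (hint.mono_set (hAΩ _)) (integrableOn_const (hAfin _)) (hAm _)
            fun v hv => hfup v hv.1
      _ = _ := by rw [setIntegral_const, smul_eq_mul]
  have hB2 : μ.real (selA m r) * ((2 * G) ^ (m + 3))⁻¹ ≤ ∫ v in selmerSimplexE m, f v ∂μ := by
    calc μ.real (selA m r) * ((2 * G) ^ (m + 3))⁻¹
        = ∫ v in selA m r, ((2 * G) ^ (m + 3))⁻¹ ∂μ := by rw [setIntegral_const, smul_eq_mul]
      _ ≤ ∫ v in selA m r, f v ∂μ := by
          refine setIntegral_mono_on (integrableOn_const (hAfin _)) (hint.mono_set (hAΩ _)) (hAm _)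
            fun v hv => ?_
          refine inv_anti₀ (pow_pos (hLpos v hv.1) _)
            (pow_le_pow_left₀ (hLpos v hv.1).le ?_ _)
          have h1 := hLup v hv.1
          have h2 : v 0 ≤ r := hv.2
          have h3 : c * r ≤ G := by
            have : c * r = G / (2 * D ^ 2) := by rw [hr]; field_simp
            rw [this]
            exact div_le_self hG0.le (by nlinarith)
          have h4 := mul_le_mul_of_nonneg_left h2 hc0.le
          linarith
      _ ≤ _ := setIntegral_mono_set hint hae (Filter.Eventually.of_forall (hAΩ r))
  have hB3 := selA_scale m r t ht ht1 hr1
  have hB : ∫ v in selmerSimplexE m \ P, f v ∂μ ≤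
      (4 * D) ^ (m + 3) * t * ∫ v in selmerSimplexE m, f v ∂μ := by
    calc _ ≤ _ := hB1
      _ ≤ (t * μ.real (selA m r)) * ((G / (2 * D)) ^ (m + 3))⁻¹ :=
          mul_le_mul_of_nonneg_right hB3 (by positivity)
      _ = (4 * D) ^ (m + 3) * t * (μ.real (selA m r) * ((2 * G) ^ (m + 3))⁻¹) := by
          have : ((G / (2 * D)) ^ (m + 3))⁻¹ = (4 * D) ^ (m + 3) * ((2 * G) ^ (m + 3))⁻¹ := by
            rw [← inv_pow, ← inv_pow, ← mul_pow]
            congr 1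
            field_simp
            ring
          rw [this]; ring
      _ ≤ _ := mul_le_mul_of_nonneg_left hB2 (by positivity)
  rw [setIntegral_sdiff hPm hint hPΩ] at hB
  have hfinal : ∫ v in P, f v ∂μ ≤ ∫ v in U, f v ∂μ :=
    setIntegral_mono_set (hint.mono_set hU) (ae_restrict_of_ae_restrict_of_subset hU hae)
      (Filter.Eventually.of_forall hPU)
  rw [le_div_iff₀ hI]
  linarith

/-- For every `ρ ∈ (0,1)` there exists `K > 0` such that, regardless of the past matrix
`N` (any finite product of `B₁` and `B₂`, including the identity), with conditional
probability at least `ρ` the first entry leaves the critical position (i.e. at some step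
`n`, `(Sⁿ(v))[d] < 2·(Sⁿ(v))[1]`) before the largest column sum increases by a factor of
`K`. -/
theorem selmer_leaves_critical (m : ℕ) (ρ : ℝ) (hρ0 : 0 < ρ) (hρ1 : ρ < 1) :
    ∃ K : ℝ, 0 < K ∧ ∀ N ∈ Submonoid.closure {selmerB1 m, selmerB2 m},
      ρ ≤ selmerCondP m N {v ∈ selmerSimplexE m | ∃ n : ℕ,
        ((selmerS m)^[n] v) (Fin.last (m + 2)) < 2 * ((selmerS m)^[n] v) 0 ∧
        colMax m (N * selmerMat m v (n + 1)) ≤ K * colMax m N} := by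
  have hb : 1 ≤ (4 * (m + 3 : ℝ)) ^ (m + 3) := one_le_pow₀ (by
    have : (0 : ℝ) ≤ m := by positivity
    linarith)
  set b := (4 * (m + 3 : ℝ)) ^ (m + 3) with hbdef
  set t := (1 - ρ) / b with ht
  have ht0 : 0 < t := div_pos (by linarith) (by linarith)
  have ht1 : t ≤ 1 := by rw [ht, div_le_iff₀ (by linarith)]; linarith
  set δ := t / (4 * (m + 3 : ℝ) ^ 2) with hδ
  have hδ0 : 0 < δ := by positivity
  refine ⟨2 / δ, by positivity, fun N hN => ?_⟩
  have hpos := colSum_pos_of_mem m N hN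
  have hmax : ∀ j, colSum m N j ≤ colMax m N := fun j =>
    le_ciSup (f := fun j => colSum m N j) (Set.finite_range _).bddAbove j
  have hbt : 1 - b * t = ρ := by
    rw [ht]; field_simp; ring
  rw [← hbt]
  refine sel_measure m (colSum m N) (colMax m N) hpos hmax t ht0 ht1 δ hδ _
    (fun v hv => hv.1) ?_
  intro v hv hle
  refine ⟨hv, ?_⟩
  obtain ⟨h0, h1, h2⟩ := selOmega_bounds m v hv
  have hcm : 0 < colMax m N := (hpos 0).trans_le (hmax 0)
  have hv1 : 0 < v 1 := by
    by_contra h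
    have : 2 * (m + 3 : ℝ) * v 1 ≤ 0 := mul_nonpos_of_nonneg_of_nonpos (by positivity) (not_lt.mp h)
    linarith
  have hLp : 0 < ∑ j, colSum m N j * v j :=
    Finset.sum_pos' (fun j _ => mul_nonneg (hpos j).le (h0 j))
      ⟨1, Finset.mem_univ _, mul_pos (hpos 1) hv1⟩
  have hv0 : 0 < v 0 := by
    have : 0 < colMax m N * v 0 := (mul_pos hδ0 hLp).trans_le hle
    exact (mul_pos_iff_of_pos_left hcm).mp this
  obtain ⟨k, hk⟩ := exists_nat_ge ((∑ j, v j) / v 0)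
  rw [div_le_iff₀ hv0] at hk
  obtain ⟨n, hn1, hn2⟩ := sel_dyn m k v N ⟨hv0, hv.2.1, hv.2.2.1⟩ hpos hk
  refine ⟨n, hn1, hn2.trans ?_⟩
  have : (∑ j, colSum m N j * v j) / v 0 ≤ colMax m N / δ := by
    rw [div_le_div_iff₀ hv0 hδ0]; linarith
  calc 2 * ((∑ j, colSum m N j * v j) / v 0) ≤ 2 * (colMax m N / δ) := by linarith
    _ = _ := by ring
end

section
/- The normalized homogeneous Euclidean algorithm is ergodic with respect to Lebesgue measure: the map T : [0,1] → [0,1] defined by T(t) = t/(1−t) for t < 1/2 and T(t) = (2t−1)/t for t ≥ 1/2 satisfies that every Lebesgue-measurable set A ⊆ [0,1] with T⁻¹(A) = A has Lebesgue measure 0 or its complement in [0,1] has Lebesgue measure 0. -/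
open MeasureTheory

/-- The normalized homogeneous Euclidean algorithm on `[0,1]` (under the identification
`t ↔ (t, 1−t)` of `[0,1]` with the one-dimensional simplex):
`T(t) = t/(1−t)` for `t < 1/2`, and `T(t) = (2t−1)/t` for `t ≥ 1/2`. -/
noncomputable def normEuclid (t : ℝ) : ℝ :=
  if t < 1 / 2 then t / (1 - t) else (2 * t - 1) / t

lemma vol_le_of_expand (f : ℝ → ℝ) (s : Set ℝ) (K : NNReal)
    (h : ∀ x ∈ s, ∀ y ∈ s, |x - y| ≤ K * |f x - f y|) :
    volume s ≤ K * volume (f '' s) := by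
  have hinj : Set.InjOn f s := by
    intro x hx y hy hxy
    have := h x hx y hy
    rw [hxy, sub_self, abs_zero, mul_zero] at this
    have := abs_nonpos_iff.1 this
    linarith
  have hl : LipschitzOnWith K (Function.invFunOn f s) (f '' s) := by
    apply LipschitzOnWith.of_dist_le_mul
    rintro _ ⟨x, hx, rfl⟩ _ ⟨y, hy, rfl⟩
    rw [hinj.leftInvOn_invFunOn hx, hinj.leftInvOn_invFunOn hy, Real.dist_eq, Real.dist_eq]
    exact h x hx y hy
  have := hl.hausdorffMeasure_image_le (d := 1) zero_le_one
  rw [hinj.leftInvOn_invFunOn.image_image, MeasureTheory.hausdorffMeasure_real] at this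
  simpa using this

/-- A Farey interval `(b/q, a/p)` around `x` whose branch map respects `A`. -/
structure FareySt (A : Set ℝ) (x : ℝ) (a b p q : ℤ) : Prop where
  hp : 0 < p
  hq : 0 < q
  det : a * q - b * p = 1
  hu : 0 < q * x - b
  hv : 0 < a - p * x
  inv : ∀ t : ℝ, 0 < t → t < 1 →
    (t ∈ A ↔ (a * t + b * (1 - t)) / (p * t + q * (1 - t)) ∈ A)

lemma inv0 {A : Set ℝ} (hinv : {t ∈ Set.Icc (0 : ℝ) 1 | normEuclid t ∈ A} = A)
    (t : ℝ) (h0 : 0 < t) (h1 : t < 1) : t ∈ A ↔ t / (1 + t) ∈ A := by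
  conv_rhs => rw [← hinv]
  have e : normEuclid (t / (1 + t)) = t := by
    unfold normEuclid
    rw [if_pos (by rw [div_lt_div_iff₀] <;> linarith)]
    have : 1 - t / (1 + t) = 1 / (1 + t) := by field_simp; ring
    rw [this]; field_simp
  have : t / (1 + t) ∈ Set.Icc (0 : ℝ) 1 :=
    ⟨by positivity, by rw [div_le_one] <;> linarith⟩
  simp only [Set.mem_ofPred_eq, e, this, true_and]

lemma inv1 {A : Set ℝ} (hinv : {t ∈ Set.Icc (0 : ℝ) 1 | normEuclid t ∈ A} = A)
    (t : ℝ) (h0 : 0 < t) (h1 : t < 1) : t ∈ A ↔ 1 / (2 - t) ∈ A := by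
  conv_rhs => rw [← hinv]
  have h2 : 0 < 2 - t := by linarith
  have e : normEuclid (1 / (2 - t)) = t := by
    unfold normEuclid
    rw [if_neg (by rw [not_lt, div_le_div_iff₀] <;> linarith)]
    field_simp; ring
  have : 1 / (2 - t) ∈ Set.Icc (0 : ℝ) 1 :=
    ⟨by positivity, by rw [div_le_one] <;> linarith⟩
  simp only [Set.mem_ofPred_eq, e, this, true_and]

lemma FareySt.den_pos {p q : ℤ} (hp : 0 < p) (hq : 0 < q) {t : ℝ} (h0 : 0 < t) (h1 : t < 1) :
    0 < p * t + q * (1 - t) := by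
  have hp' : (0 : ℝ) < p := by exact_mod_cast hp
  have hq' : (0 : ℝ) < q := by exact_mod_cast hq
  have : 0 < 1 - t := by linarith
  positivity

lemma FareySt.step0 {A : Set ℝ} (hinv : {t ∈ Set.Icc (0 : ℝ) 1 | normEuclid t ∈ A} = A)
    {x : ℝ} {a b p q : ℤ} (h : FareySt A x a b p q) (hlt : q * x - b < a - p * x) :
    FareySt A x (a + b) b (p + q) q := by
  obtain ⟨hp, hq, det, hu, hv, inv⟩ := h
  refine ⟨by omega, hq, by linarith, hu, by push_cast; linarith, fun t h0 h1 => ?_⟩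
  have hs0 : 0 < t / (1 + t) := by positivity
  have hs1 : t / (1 + t) < 1 := by rw [div_lt_one] <;> linarith
  rw [inv0 hinv t h0 h1, inv _ hs0 hs1]
  have d1 := FareySt.den_pos hp hq hs0 hs1
  have d2 := FareySt.den_pos (by omega : 0 < p + q) hq h0 h1
  have e1 : p * (t / (1 + t)) + q * (1 - t / (1 + t)) = (((p + q : ℤ) : ℝ) * t + q * (1 - t)) / (1 + t) := by
    push_cast; field_simp; ring
  have e2 : a * (t / (1 + t)) + b * (1 - t / (1 + t)) = (((a + b : ℤ) : ℝ) * t + b * (1 - t)) / (1 + t) := by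
    push_cast; field_simp; ring
  rw [e1, e2, div_div_div_cancel_right₀ (by positivity)]

lemma FareySt.step1 {A : Set ℝ} (hinv : {t ∈ Set.Icc (0 : ℝ) 1 | normEuclid t ∈ A} = A)
    {x : ℝ} {a b p q : ℤ} (h : FareySt A x a b p q) (hlt : a - p * x < q * x - b) :
    FareySt A x a (a + b) p (p + q) := by
  obtain ⟨hp, hq, det, hu, hv, inv⟩ := h
  refine ⟨hp, by omega, by linarith, by push_cast; linarith, hv, fun t h0 h1 => ?_⟩
  have h2 : 0 < 2 - t := by linarith
  have hs0 : 0 < 1 / (2 - t) := by positivity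
  have hs1 : 1 / (2 - t) < 1 := by rw [div_lt_one] <;> linarith
  rw [inv1 hinv t h0 h1, inv _ hs0 hs1]
  have e1 : p * (1 / (2 - t)) + q * (1 - 1 / (2 - t)) = (p * t + ((p + q : ℤ) : ℝ) * (1 - t)) / (2 - t) := by
    push_cast; field_simp; ring
  have e2 : a * (1 / (2 - t)) + b * (1 - 1 / (2 - t)) = (a * t + ((a + b : ℤ) : ℝ) * (1 - t)) / (2 - t) := by
    push_cast; field_simp; ring
  rw [e1, e2, div_div_div_cancel_right₀ (by positivity)]

lemma exists_quot {u v : ℝ} (hu : 0 < u) (huv : u < v) (hne : ∀ k : ℕ, (k : ℝ) * u ≠ v) :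
    ∃ k : ℕ, 1 ≤ k ∧ k * u < v ∧ v < (k + 1) * u := by
  have hv : 0 ≤ v / u := by have := hu.trans huv; positivity
  refine ⟨⌊v / u⌋₊, ?_, ?_, ?_⟩
  · rw [Nat.one_le_floor_iff, le_div_iff₀ hu]; linarith
  · refine lt_of_le_of_ne ?_ (hne _)
    rw [← le_div_iff₀ hu]; exact Nat.floor_le hv
  · rw [← div_lt_iff₀ hu]; exact Nat.lt_floor_add_one _

lemma FareySt.iter0 {A : Set ℝ} (hinv : {t ∈ Set.Icc (0 : ℝ) 1 | normEuclid t ∈ A} = A)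
    {x : ℝ} {a b p q : ℤ} (h : FareySt A x a b p q) (k : ℕ)
    (hlt : k * (q * x - b) < a - p * x) :
    FareySt A x (a + k * b) b (p + k * q) q := by
  induction k with
  | zero => simpa using h
  | succ k ih =>
    push_cast at hlt
    have hu := h.hu
    have h1 := (ih (by linarith)).step0 hinv (by push_cast; linarith)
    convert h1 using 1 <;> (push_cast; ring)

lemma FareySt.iter1 {A : Set ℝ} (hinv : {t ∈ Set.Icc (0 : ℝ) 1 | normEuclid t ∈ A} = A)
    {x : ℝ} {a b p q : ℤ} (h : FareySt A x a b p q) (k : ℕ)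
    (hlt : k * (a - p * x) < q * x - b) :
    FareySt A x a (b + k * a) p (q + k * p) := by
  induction k with
  | zero => simpa using h
  | succ k ih =>
    push_cast at hlt
    have hv := h.hv
    have h1 := (ih (by linarith)).step1 hinv (by push_cast; linarith)
    convert h1 using 1 <;> (push_cast; ring)

lemma irr_ne {x : ℝ} (hx : Irrational x) {m n : ℤ} (hm : 0 < m) : (m : ℝ) * x ≠ n := by
  intro h
  have hm' : (m : ℝ) ≠ 0 := by exact_mod_cast hm.ne'
  apply hx
  refine ⟨(n : ℚ) / m, ?_⟩
  push_cast
  rw [← h]; field_simp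

lemma FareySt.next {A : Set ℝ} (hinv : {t ∈ Set.Icc (0 : ℝ) 1 | normEuclid t ∈ A} = A)
    {x : ℝ} (hx : Irrational x) {a b p q : ℤ} (h : FareySt A x a b p q) :
    ∃ a' b' p' q', FareySt A x a' b' p' q' ∧ p' ≤ 2 * q' ∧ q' ≤ 2 * p' ∧ p + q < p' + q' := by
  have hp := h.hp
  have hq := h.hq
  have hu := h.hu
  have hv := h.hv
  rcases lt_trichotomy (q * x - b) (a - p * x) with hlt | heq | hlt
  · obtain ⟨k, hk, h1, h2⟩ := exists_quot hu hlt (by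
      intro k hk
      apply irr_ne hx (m := p + k * q) (n := a + k * b) (by positivity)
      push_cast; linarith)
    have h3 := (h.iter0 hinv k h1).step1 hinv (by push_cast; linarith)
    have hk' : (1 : ℤ) ≤ k := by exact_mod_cast hk
    have : q ≤ k * q := le_mul_of_one_le_left hq.le hk'
    exact ⟨_, _, _, _, h3, by linarith, by linarith, by linarith⟩
  · exfalso
    apply irr_ne hx (m := p + q) (n := a + b) (by positivity)
    push_cast; linarith
  · obtain ⟨k, hk, h1, h2⟩ := exists_quot hv hlt (by
      intro k hk
      apply irr_ne hx (m := q + k * p) (n := b + k * a) (by positivity)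
      push_cast; linarith)
    have h3 := (h.iter1 hinv k h1).step0 hinv (by push_cast; linarith)
    have hk' : (1 : ℤ) ≤ k := by exact_mod_cast hk
    have : p ≤ k * p := le_mul_of_one_le_left hp.le hk'
    exact ⟨_, _, _, _, h3, by linarith, by linarith, by linarith⟩

lemma FareySt.large {A : Set ℝ} (hinv : {t ∈ Set.Icc (0 : ℝ) 1 | normEuclid t ∈ A} = A)
    {x : ℝ} (hx : Irrational x) (h0 : 0 < x) (h1 : x < 1) (n : ℕ) :
    ∃ a b p q, FareySt A x a b p q ∧ p ≤ 2 * q ∧ q ≤ 2 * p ∧ (n : ℤ) + 2 ≤ p + q := by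
  induction n with
  | zero =>
    refine ⟨1, 0, 1, 1, ⟨by norm_num, by norm_num, by norm_num, by simpa, by simpa, ?_⟩,
      by norm_num, by norm_num, by norm_num⟩
    intro t _ _
    simp
  | succ n ih =>
    obtain ⟨a, b, p, q, h, -, -, hn⟩ := ih
    obtain ⟨a', b', p', q', h', h1, h2, h3⟩ := h.next hinv hx
    exact ⟨a', b', p', q', h', h1, h2, by push_cast; linarith⟩

/-- Definite proportion of the complement in each balanced interval. -/
lemma FareySt.vol {A : Set ℝ} {x : ℝ} {a b p q : ℤ} (h : FareySt A x a b p q)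
    (h1 : p ≤ 2 * q) (h2 : q ≤ 2 * p) :
    volume (Set.Ioo (0 : ℝ) 1 \ A) ≤
      5 * (volume (Set.Icc ((b : ℝ) / q) (a / p) \ A) / volume (Set.Icc ((b : ℝ) / q) (a / p))) := by
  obtain ⟨hp, hq, det, hu, hv, inv⟩ := h
  have hp' : (0 : ℝ) < p := by exact_mod_cast hp
  have hq' : (0 : ℝ) < q := by exact_mod_cast hq
  have h1' : (p : ℝ) ≤ 2 * q := by exact_mod_cast h1
  have h2' : (q : ℝ) ≤ 2 * p := by exact_mod_cast h2
  have det' : (a : ℝ) * q - b * p = 1 := by exact_mod_cast det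
  have hpq : (0 : ℝ) < p * q := by positivity
  have hvI : volume (Set.Icc ((b : ℝ) / q) (a / p)) = ENNReal.ofReal (1 / (p * q)) := by
    rw [Real.volume_Icc]
    congr 1
    field_simp
    linarith
  set f : ℝ → ℝ := fun t => (a * t + b * (1 - t)) / (p * t + q * (1 - t)) with hf
  have hK : 0 ≤ 5 * ((p : ℝ) * q) := by positivity
  have key := vol_le_of_expand f (Set.Ioo (0 : ℝ) 1 \ A) (5 * ((p : ℝ) * q)).toNNReal (by
    rintro s ⟨⟨hs0, hs1⟩, -⟩ t ⟨⟨ht0, ht1⟩, -⟩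
    have ds := FareySt.den_pos hp hq hs0 hs1
    have dt := FareySt.den_pos hp hq ht0 ht1
    have e : f s - f t = (s - t) / ((p * s + q * (1 - s)) * (p * t + q * (1 - t))) := by
      simp only [hf]
      rw [div_sub_div _ _ ds.ne' dt.ne']
      congr 1
      linear_combination (s - t) * det'
    rw [e, abs_div, abs_of_pos (mul_pos ds dt), Real.coe_toNNReal _ hK, mul_div_assoc',
      le_div_iff₀ (mul_pos ds dt), mul_comm]
    apply mul_le_mul_of_nonneg_right _ (abs_nonneg _)
    have bs : p * s + q * (1 - s) ≤ p + q := by nlinarith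
    have bt : p * t + q * (1 - t) ≤ p + q := by nlinarith
    calc _ ≤ ((p : ℝ) + q) * (p + q) := mul_le_mul bs bt dt.le (by positivity)
      _ ≤ _ := by nlinarith [mul_nonneg (sub_nonneg.2 h1') (sub_nonneg.2 h2')])
  have hsub : f '' (Set.Ioo (0 : ℝ) 1 \ A) ⊆ Set.Icc ((b : ℝ) / q) (a / p) \ A := by
    rintro _ ⟨t, ⟨⟨ht0, ht1⟩, htA⟩, rfl⟩
    have dt := FareySt.den_pos hp hq ht0 ht1
    refine ⟨⟨?_, ?_⟩, fun hc => htA ((inv t ht0 ht1).2 hc)⟩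
    · simp only [hf]
      rw [div_le_div_iff₀ hq' dt]
      nlinarith
    · simp only [hf]
      rw [div_le_div_iff₀ dt hp']
      nlinarith
  refine key.trans ((mul_le_mul_right (measure_mono hsub) _).trans (le_of_eq ?_))
  rw [hvI, ENNReal.div_eq_inv_mul, ← ENNReal.ofReal_inv_of_pos (by positivity), ← mul_assoc (5 : ENNReal)]
  congr 1
  rw [one_div, inv_inv, ← ENNReal.ofReal_ofNat 5, ← ENNReal.ofReal_mul (by norm_num)]
  rfl

/-- The normalized homogeneous Euclidean algorithm is ergodic with respect to Lebesgue
measure on `[0,1]`. -/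
theorem normEuclid_ergodic (A : Set ℝ) (hA : NullMeasurableSet A volume)
    (hsub : A ⊆ Set.Icc 0 1)
    (hinv : {t ∈ Set.Icc (0 : ℝ) 1 | normEuclid t ∈ A} = A) :
    volume A = 0 ∨ volume (Set.Icc (0 : ℝ) 1 \ A) = 0 := by
  by_cases hA0 : volume A = 0
  · exact Or.inl hA0
  right
  have hne : (volume.restrict A) ≠ 0 := by
    rwa [Ne, Measure.restrict_eq_zero]
  have hirr : ∀ᵐ x ∂(volume.restrict A), Irrational x := by
    apply ae_restrict_of_ae
    rw [ae_iff]
    have : {x : ℝ | ¬ Irrational x} = Set.range ((↑) : ℚ → ℝ) := by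
      ext x; simp [Irrational]
    rw [this]
    exact (Set.countable_range _).measure_zero _
  have hmem : ∀ᵐ x ∂(volume.restrict A), x ∈ A := ae_restrict_mem₀ hA
  have hden := IsUnifLocDoublingMeasure.ae_tendsto_measure_inter_div (volume : Measure ℝ) A 1
  have : (ae (volume.restrict A)).NeBot := ae_neBot.2 hne
  obtain ⟨x, hx, hxA, hd⟩ := (hirr.and (hmem.and hden)).exists
  have hx01 := hsub hxA
  have hx0 : 0 < x := lt_of_le_of_ne hx01.1 (fun h => hx.ne_zero h.symm)
  have hx1 : x < 1 := lt_of_le_of_ne hx01.2 hx.ne_one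
  choose a b p q hst h1 h2 h3 using FareySt.large hinv hx hx0 hx1
  have hpp : ∀ n, (0 : ℝ) < p n := fun n => by exact_mod_cast (hst n).hp
  have hqq : ∀ n, (0 : ℝ) < q n := fun n => by exact_mod_cast (hst n).hq
  have hdet : ∀ n, (a n : ℝ) * q n - b n * p n = 1 := fun n => by exact_mod_cast (hst n).det
  have hball : ∀ n, Metric.closedBall (((b n : ℝ) / q n + a n / p n) / 2) (1 / (2 * (p n * q n)))
      = Set.Icc ((b n : ℝ) / q n) (a n / p n) := by
    intro n
    have := hpp n
    have := hqq n
    have e : (1 : ℝ) / (2 * (p n * q n)) = (a n / p n - b n / q n) / 2 := by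
      field_simp
      linarith [hdet n]
    rw [Real.Icc_eq_closedBall, e]
  have hlim := hd (l := Filter.atTop) (fun n : ℕ => ((b n : ℝ) / q n + a n / p n) / 2)
    (fun n => 1 / (2 * (p n * q n))) (by
      rw [tendsto_nhdsWithin_iff]
      constructor
      · refine squeeze_zero (fun n => ?_) (fun n => ?_) (tendsto_one_div_add_atTop_nhds_zero_nat (𝕜 := ℝ))
        · have := hpp n
          have := hqq n
          positivity
        · apply one_div_le_one_div_of_le (by positivity)
          have e1 : (1 : ℝ) ≤ p n := by exact_mod_cast (hst n).hp
          have e2 : (1 : ℝ) ≤ q n := by exact_mod_cast (hst n).hq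
          have e3 : (n : ℝ) + 2 ≤ p n + q n := by exact_mod_cast h3 n
          nlinarith [mul_nonneg (sub_nonneg.2 e1) (sub_nonneg.2 e2)]
      · refine Filter.Eventually.of_forall fun n => ?_
        have := hpp n
        have := hqq n
        simp only [Set.mem_Ioi]
        positivity)
    (by
      refine Filter.Eventually.of_forall fun n => ?_
      rw [one_mul, hball]
      have hu := (hst n).hu
      have hv := (hst n).hv
      constructor
      · rw [div_le_iff₀ (hqq n)]; linarith
      · rw [le_div_iff₀ (hpp n)]; linarith)
  simp only [hball] at hlim
  have hlim2 : Filter.Tendsto (fun n => volume (Set.Icc ((b n : ℝ) / q n) (a n / p n) \ A) /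
      volume (Set.Icc ((b n : ℝ) / q n) (a n / p n))) Filter.atTop (nhds 0) := by
    have h4 := ENNReal.Tendsto.sub (tendsto_const_nhds (x := (1 : ENNReal)) (f := Filter.atTop)) hlim
      (Or.inl ENNReal.one_ne_top)
    rw [tsub_self] at h4
    refine h4.congr fun n => ?_
    set I := Set.Icc ((b n : ℝ) / q n) (a n / p n) with hI
    have hfin : volume I ≠ ⊤ := by rw [hI, Real.volume_Icc]; exact ENNReal.ofReal_ne_top
    have hpos : volume I ≠ 0 := by
      rw [hI, Real.volume_Icc, Ne, ENNReal.ofReal_eq_zero, not_le, sub_pos,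
        div_lt_div_iff₀ (hqq n) (hpp n)]
      linarith [hdet n]
    have hadd : volume (I ∩ A) + volume (I \ A) = volume I := measure_inter_add_sdiff₀ I hA
    have hAf : volume (A ∩ I) / volume I ≠ ⊤ :=
      ENNReal.div_ne_top (ne_top_of_le_ne_top hfin (measure_mono Set.inter_subset_right)) hpos
    rw [Set.inter_comm] at hadd
    apply ENNReal.sub_eq_of_eq_add hAf
    rw [← ENNReal.add_div, add_comm, hadd, ENNReal.div_self hpos hfin]
  have hlim3 := ENNReal.Tendsto.const_mul (a := 5) hlim2 (Or.inr (by norm_num))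
  rw [mul_zero] at hlim3
  have hz : volume (Set.Ioo (0 : ℝ) 1 \ A) ≤ 0 :=
    ge_of_tendsto' hlim3 fun n => (hst n).vol (h1 n) (h2 n)
  have hz' := le_antisymm hz bot_le
  rw [← hz']
  exact measure_congr (Ioo_ae_eq_Icc.symm.diff (Filter.EventuallyEq.refl _ _))
end
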